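/- Let G be a connected finite simple graph that is (C_3, C_4)-free, i.e., G contains no induced cycle on three vertices and no induced cycle on four vertices. If G is not isomorphic to the cycle C_6, then χ_D(G) ≤ Δ(G) + 1. -/

import Mathlib

open SimpleGraph

/-- A proper colouring `c` of `G` is distinguishing if the identity is the only
automorphism of `G` preserving `c`. -/
def SimpleGraph.IsDistinguishingColoring {V α : Type*} (G : SimpleGraph V)
    (c : G.Coloring α) : Prop :=
  ∀ φ : G ≃g G, (∀ v, c (φ v) = c v) → ∀ v, φ v = v

/-- The distinguishing chromatic number of `G`: the least `k` such that `G` has a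
proper vertex colouring with `k` colours preserved only by the identity automorphism. -/
noncomputable def SimpleGraph.distChromNum {V : Type*} (G : SimpleGraph V) : ℕ :=
  sInf {k | ∃ c : G.Coloring (Fin k), G.IsDistinguishingColoring c}

/-- The maximum degree of `G`, stated without decidability assumptions. -/
noncomputable def SimpleGraph.maxDeg {V : Type*} [Fintype V] (G : SimpleGraph V) : ℕ := by
  classical exact G.maxDegree

/-- `G` contains no induced subgraph isomorphic to `H`. -/
def SimpleGraph.IsFreeOf {V W : Type*} (G : SimpleGraph V) (H : SimpleGraph W) : Prop :=
  ¬ Nonempty (H ↪g G)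



section helpers
open Finset
variable {V : Type*}

theorem no_tri (G : SimpleGraph V) (hC3 : G.IsFreeOf (cycleGraph 3)) :
    ∀ a b c, G.Adj a b → G.Adj b c → G.Adj c a → False := by
  intro a b c hab hbc hca
  apply hC3
  have h1 := hab.ne; have h2 := hbc.ne; have h3 := hca.ne
  refine ⟨⟨⟨![a, b, c], ?_⟩, ?_⟩⟩
  · intro i j; fin_cases i <;> fin_cases j <;> simp <;> grind
  · intro i j
    have e1 : (cycleGraph 3).Adj i j ↔ i ≠ j := by revert i j; decide
    rw [e1]
    change G.Adj (![a, b, c] i) (![a, b, c] j) ↔ _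
    clear e1
    fin_cases i <;> fin_cases j <;> simp [hab, hbc, hca, hab.symm, hbc.symm, hca.symm]

theorem no_quad (G : SimpleGraph V) (hC3 : G.IsFreeOf (cycleGraph 3))
    (hC4 : G.IsFreeOf (cycleGraph 4)) :
    ∀ a b c d, a ≠ b → G.Adj c a → G.Adj c b → G.Adj d a → G.Adj d b → c = d := by
  intro a b c d hab hca hcb hda hdb
  by_contra hcd
  have hT := no_tri G hC3
  have nab : ¬ G.Adj a b := fun h => hT a b c h hcb.symm hca
  have nba : ¬ G.Adj b a := fun h => nab h.symm
  have ncd : ¬ G.Adj c d := fun h => hT a c d hca.symm h hda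
  have ndc : ¬ G.Adj d c := fun h => ncd h.symm
  apply hC4
  have h1 := hca.ne; have h2 := hcb.ne; have h3 := hda.ne; have h4 := hdb.ne
  refine ⟨⟨⟨![a, c, b, d], ?_⟩, ?_⟩⟩
  · intro i j; fin_cases i <;> fin_cases j <;> simp <;> grind
  · intro i j
    have e1 : (cycleGraph 4).Adj i j ↔ (j = i + 1 ∨ i = j + 1) := by revert i j; decide
    rw [e1]
    change G.Adj (![a, c, b, d] i) (![a, c, b, d] j) ↔ _
    clear e1
    fin_cases i <;> fin_cases j <;>
      simp [hca, hcb, hda, hdb, hca.symm, hcb.symm, hda.symm, hdb.symm, nab, nba, ncd, ndc]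

theorem inj_six {a b c d e f : V} (h1 : a ≠ b) (h2 : a ≠ c) (h3 : a ≠ d) (h4 : a ≠ e) (h5 : a ≠ f)
    (h6 : b ≠ c) (h7 : b ≠ d) (h8 : b ≠ e) (h9 : b ≠ f) (h10 : c ≠ d) (h11 : c ≠ e) (h12 : c ≠ f)
    (h13 : d ≠ e) (h14 : d ≠ f) (h15 : e ≠ f) : Function.Injective ![a, b, c, d, e, f] := by
  intro i j
  fin_cases i <;> fin_cases j <;>
    simp [h1, h2, h3, h4, h5, h6, h7, h8, h9, h10, h11, h12, h13, h14, h15, h1.symm, h2.symm,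
      h3.symm, h4.symm, h5.symm, h6.symm, h7.symm, h8.symm, h9.symm, h10.symm, h11.symm, h12.symm,
      h13.symm, h14.symm, h15.symm]

variable [Fintype V] [DecidableEq V]

/-- partial proper colouring of `S` with colours `0..D`, no isolated vertex in `S`. -/
def OkCol (G : SimpleGraph V) (D : ℕ) (S : Finset V) (c : V → ℕ) : Prop :=
  (∀ a ∈ S, ∀ b ∈ S, G.Adj a b → c a ≠ c b) ∧ (∀ a ∈ S, c a ≤ D) ∧ (∀ a ∈ S, ∃ b ∈ S, G.Adj a b)

/-- `(T, f)` extends `(S, c)`. -/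
def ExtCol (G : SimpleGraph V) (D : ℕ) (S : Finset V) (c : V → ℕ) (T : Finset V) (f : V → ℕ) :
    Prop :=
  S ⊆ T ∧ (∀ a ∈ S, f a = c a) ∧
  (∀ a ∈ T, a ∉ S → f a = 0 → ∀ k, 1 ≤ k → k ≤ D → ∃ b ∈ T, G.Adj a b ∧ f b = k) ∧
  (∀ (F : V → ℕ) (φ : G ≃g G), (∀ a ∈ T, F a = f a) → (∀ a, F (φ a) = F a) →
    (∀ a ∈ S, φ a = a) → ∀ a ∈ T, φ a = a)

theorem ExtCol.trans {G : SimpleGraph V} {D : ℕ} {S T U : Finset V} {c f g : V → ℕ}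
    (h1 : ExtCol G D S c T f) (h2 : ExtCol G D T f U g) : ExtCol G D S c U g := by
  obtain ⟨a1, a2, a3, a4⟩ := h1
  obtain ⟨b1, b2, b3, b4⟩ := h2
  refine ⟨a1.trans b1, fun a ha => (b2 a (a1 ha)).trans (a2 a ha), ?_, ?_⟩
  · intro a ha haS h0 k hk1 hk2
    by_cases haT : a ∈ T
    · obtain ⟨b, hb, hab, hbk⟩ := a3 a haT haS (by rw [← b2 a haT]; exact h0) k hk1 hk2
      exact ⟨b, b1 hb, hab, by rw [b2 b hb]; exact hbk⟩
    · exact b3 a ha haT h0 k hk1 hk2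
  · intro F φ hF hφ hS
    exact b4 F φ hF hφ (a4 F φ (fun a ha => (hF a (b1 ha)).trans (b2 a ha)) hφ hS)

theorem exists_inj_pin (W : Finset V) (C : Finset ℕ) (h : #W ≤ #C) (w0 : V) (k : ℕ)
    (hk : w0 ∈ W → k ∈ C) :
    ∃ g : V → ℕ, (∀ w ∈ W, g w ∈ C) ∧ (∀ a ∈ W, ∀ b ∈ W, g a = g b → a = b) ∧
      (w0 ∈ W → g w0 = k) := by
  have : ∃ g : V → ℕ, (∀ w ∈ W, g w ∈ C) ∧ (∀ a ∈ W, ∀ b ∈ W, g a = g b → a = b) := by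
    obtain ⟨e⟩ : Nonempty (W ↪ C) := by
      rw [Function.Embedding.nonempty_iff_card_le]; simpa using h
    refine ⟨fun w => if h : w ∈ W then (e ⟨w, h⟩ : ℕ) else 0, ?_, ?_⟩
    · intro w hw; simp [hw]
    · intro a ha b hb hab
      simp only [ha, hb, dif_pos] at hab
      have := e.injective (Subtype.ext hab)
      simpa using this
  obtain ⟨g, h1, h2⟩ := this
  by_cases hw0 : w0 ∈ W
  · refine ⟨fun w => Equiv.swap (g w0) k (g w), ?_, ?_, ?_⟩
    · intro w hw
      have := h1 w hw; have := h1 w0 hw0; have := hk hw0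
      simp only [Equiv.swap_apply_def]; split_ifs <;> assumption
    · intro a ha b hb hab
      exact h2 a ha b hb ((Equiv.swap (g w0) k).injective hab)
    · intro _; simp
  · exact ⟨g, h1, h2, fun h => absurd h hw0⟩

theorem step (G : SimpleGraph V) [DecidableRel G.Adj] (D : ℕ) (hdeg : ∀ v, G.degree v ≤ D)
    (hT : ∀ a b c, G.Adj a b → G.Adj b c → G.Adj c a → False)
    (hQ : ∀ a b c d, a ≠ b → G.Adj c a → G.Adj c b → G.Adj d a → G.Adj d b → c = d)
    (S : Finset V) (c : V → ℕ) (hok : OkCol G D S c) (p : V) (hp : p ∈ S) (w0 : V) (k0 : ℕ)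
    (hk0 : w0 ∉ S → 1 ≤ k0 ∧ k0 ≤ D ∧ ∀ b ∈ S, G.Adj w0 b → c b ≠ k0) :
    ∃ f, OkCol G D (S ∪ G.neighborFinset p) f ∧ ExtCol G D S c (S ∪ G.neighborFinset p) f ∧
      (∀ a, G.Adj p a → a ∉ S → f a = 0 → ∀ k, 1 ≤ k → k ≤ D → ∃ b ∈ S, G.Adj a b ∧ c b = k) ∧
      (G.Adj p w0 → w0 ∉ S → f w0 = k0) := by
  obtain ⟨hprop, hle, hnb⟩ := hok
  obtain ⟨q, hq, hpq⟩ := hnb p hp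
  set W1 : Finset V := {w ∈ G.neighborFinset p | w ∉ S ∧ ∀ b ∈ S, G.Adj w b → b = p} with hW1
  have mW1 : ∀ w, w ∈ W1 ↔ G.Adj p w ∧ w ∉ S ∧ ∀ b ∈ S, G.Adj w b → b = p := by
    intro w; simp [hW1]
  set C : Finset ℕ := (Finset.Icc 1 D).erase (c p) with hC
  have hcard : #W1 ≤ #C := by
    have h1 : #W1 ≤ #((G.neighborFinset p).erase q) := by
      apply card_le_card
      intro w hw
      rw [mW1] at hw
      rw [mem_erase, mem_neighborFinset]
      exact ⟨fun h => hw.2.1 (h ▸ hq), hw.1⟩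
    rw [card_erase_of_mem (by simpa using hpq), card_neighborFinset_eq_degree] at h1
    have h2 : D - 1 ≤ #C := by
      have := pred_card_le_card_erase (s := Finset.Icc 1 D) (a := c p)
      simpa using this
    have := hdeg p
    omega
  obtain ⟨g, g1, g2, g3⟩ := exists_inj_pin W1 C hcard w0 k0 (by
    intro h
    rw [mW1] at h
    obtain ⟨x1, x2, x3⟩ := hk0 h.2.1
    rw [hC, mem_erase, mem_Icc]
    exact ⟨(x3 p hp h.1.symm).symm, x1, x2⟩)
  have hh : ∀ w, ∃ m, w ∉ S → (m ≤ D ∧ (∀ b ∈ S, G.Adj w b → c b ≠ m) ∧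
      (m = 0 → ∀ k, 1 ≤ k → k ≤ D → ∃ b ∈ S, G.Adj w b ∧ c b = k) ∧ (w = w0 → m = k0)) := by
    intro w
    by_cases hwS : w ∈ S
    · exact ⟨0, fun h => absurd hwS h⟩
    by_cases hw0 : w = w0
    · subst hw0
      obtain ⟨x1, x2, x3⟩ := hk0 hwS
      exact ⟨k0, fun _ => ⟨x2, x3, by omega, fun _ => rfl⟩⟩
    by_cases hex : ∃ m, 1 ≤ m ∧ m ≤ D ∧ ∀ b ∈ S, G.Adj w b → c b ≠ m
    · obtain ⟨m, x1, x2, x3⟩ := hex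
      exact ⟨m, fun _ => ⟨x2, x3, by omega, fun h => absurd h hw0⟩⟩
    · push Not at hex
      refine ⟨0, fun _ => ⟨Nat.zero_le _, ?_, ?_, fun h => absurd h hw0⟩⟩
      · intro b hb hwb h0
        have : Finset.range (D + 1) ⊆ (G.neighborFinset w).image c := by
          intro m hm
          rw [mem_range] at hm
          rw [mem_image]
          by_cases hm0 : m = 0
          · exact ⟨b, by simpa using hwb, by omega⟩
          · obtain ⟨b', _, h2, h3⟩ := hex m (by omega) (by omega)
            exact ⟨b', by simpa using h2, h3⟩
        have h1 := card_le_card this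
        have h2 := card_image_le (s := G.neighborFinset w) (f := c)
        have h3 := hdeg w
        rw [card_range] at h1
        rw [card_neighborFinset_eq_degree] at h2
        omega
      · intro _ k hk1 hk2
        obtain ⟨b, x1, x2, x3⟩ := hex k hk1 hk2
        exact ⟨b, x1, x2, x3⟩
  choose h hh using hh
  set f : V → ℕ := fun a => if a ∈ S then c a else if a ∈ W1 then g a else h a with hf
  have fS : ∀ a ∈ S, f a = c a := fun a ha => by simp [hf, ha]
  have fW : ∀ a ∈ W1, f a = g a := fun a ha => by
    have := ((mW1 a).1 ha).2.1
    simp [hf, ha, this]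
  have fN : ∀ a, a ∉ S → a ∉ W1 → f a = h a := fun a ha hb => by simp [hf, ha, hb]
  have memT : ∀ a, a ∈ S ∪ G.neighborFinset p ↔ a ∈ S ∨ G.Adj p a := by intro a; simp
  have key : ∀ a b, a ∈ S → b ∉ S → G.Adj b a → f a ≠ f b := by
    intro a b ha hb hab
    rw [fS a ha]
    by_cases hbW : b ∈ W1
    · rw [fW b hbW]
      have h1 := ((mW1 b).1 hbW).2.2 a ha hab
      have h2 := g1 b hbW
      rw [hC, mem_erase] at h2
      subst h1
      exact h2.1.symm
    · rw [fN b hb hbW]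
      exact (hh b hb).2.1 a ha hab
  have zero : ∀ a, G.Adj p a → a ∉ S → f a = 0 → ∀ k, 1 ≤ k → k ≤ D →
      ∃ b ∈ S, G.Adj a b ∧ c b = k := by
    intro a hpa haS h0
    by_cases haW : a ∈ W1
    · have h2 := g1 a haW
      rw [hC, mem_erase, mem_Icc] at h2
      rw [fW a haW] at h0
      omega
    · rw [fN a haS haW] at h0
      exact (hh a haS).2.2.1 h0
  refine ⟨f, ⟨?_, ?_, ?_⟩, ⟨subset_union_left, fS, ?_, ?_⟩, zero, ?_⟩
  · intro a ha b hb hab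
    rw [memT] at ha hb
    by_cases haS : a ∈ S
    · by_cases hbS : b ∈ S
      · rw [fS a haS, fS b hbS]; exact hprop a haS b hbS hab
      · exact key a b haS hbS hab.symm
    · by_cases hbS : b ∈ S
      · exact (key b a hbS haS hab).symm
      · exact (hT p a b (ha.resolve_left haS) hab (hb.resolve_left hbS).symm).elim
  · intro a ha
    by_cases haS : a ∈ S
    · rw [fS a haS]; exact hle a haS
    · by_cases haW : a ∈ W1
      · have h2 := g1 a haW
        rw [hC, mem_erase, mem_Icc] at h2
        rw [fW a haW]; omega
      · rw [fN a haS haW]; exact (hh a haS).1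
  · intro a ha
    rw [memT] at ha
    rcases ha with ha | ha
    · obtain ⟨b, hb, hab⟩ := hnb a ha
      exact ⟨b, (memT b).2 (Or.inl hb), hab⟩
    · exact ⟨p, (memT p).2 (Or.inl hp), ha.symm⟩
  · intro a ha haS h0 k hk1 hk2
    obtain ⟨b, hb, hab, hbk⟩ := zero a (((memT a).1 ha).resolve_left haS) haS h0 k hk1 hk2
    exact ⟨b, (memT b).2 (Or.inl hb), hab, (fS b hb).trans hbk⟩
  · intro F φ hF hφ hfix a ha
    by_cases haS : a ∈ S
    · exact hfix a haS
    have hpa := ((memT a).1 ha).resolve_left haS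
    have hpa' : G.Adj p (φ a) := by
      have := (φ.map_adj_iff).2 hpa
      rwa [hfix p hp] at this
    have hS' : φ a ∉ S := fun h => haS (by
      have h1 := hfix _ h
      rw [← φ.injective h1]; exact h)
    by_cases haW : a ∈ W1
    · have h1 := (mW1 a).1 haW
      have hW' : φ a ∈ W1 := by
        rw [mW1]
        refine ⟨hpa', hS', fun b hb hab => h1.2.2 b hb ?_⟩
        rw [← hfix b hb] at hab
        exact (φ.map_adj_iff).1 hab
      apply g2 _ hW' _ haW
      rw [← fW _ hW', ← fW _ haW, ← hF a ha, ← hF _ ((memT _).2 (Or.inr hpa')), hφ]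
    · have : ∃ b ∈ S, G.Adj a b ∧ b ≠ p := by
        by_contra hcon
        push Not at hcon
        exact haW ((mW1 a).2 ⟨hpa, haS, hcon⟩)
      obtain ⟨b, hb, hab, hbp⟩ := this
      have hab' : G.Adj (φ a) b := by
        have := (φ.map_adj_iff).2 hab
        rwa [hfix b hb] at this
      exact hQ b p _ _ hbp hab' hpa'.symm hab hpa.symm
  · intro hpw hwS
    by_cases hwW : w0 ∈ W1
    · rw [fW _ hwW]; exact g3 hwW
    · rw [fN _ hwS hwW]; exact (hh w0 hwS).2.2.2 rfl

theorem exists_boundary (G : SimpleGraph V) (hconn : G.Connected) (S : Finset V)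
    (hne : S.Nonempty) (hS : S ≠ univ) : ∃ p ∈ S, ∃ w, w ∉ S ∧ G.Adj p w := by
  by_contra hcon
  push Not at hcon
  obtain ⟨v, hv⟩ := hne
  apply hS
  rw [eq_univ_iff_forall]
  intro w
  obtain ⟨P⟩ := hconn.preconnected v w
  induction P with
  | nil => exact hv
  | cons h _ ih => 
    apply ih
    by_contra hc
    exact hcon _ hv _ hc h

theorem iterate (G : SimpleGraph V) [DecidableRel G.Adj] (hconn : G.Connected)
    (D : ℕ) (hdeg : ∀ v, G.degree v ≤ D)
    (hT : ∀ a b c, G.Adj a b → G.Adj b c → G.Adj c a → False)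
    (hQ : ∀ a b c d, a ≠ b → G.Adj c a → G.Adj c b → G.Adj d a → G.Adj d b → c = d) (n : ℕ) :
    ∀ (S : Finset V) (c : V → ℕ), #(Sᶜ) ≤ n → S.Nonempty → OkCol G D S c →
    ∃ f, OkCol G D univ f ∧ ExtCol G D S c univ f := by
  induction n with
  | zero =>
    intro S c hn hne hok
    have : S = univ := by simpa using hn
    subst this
    exact ⟨c, hok, subset_univ _, fun _ _ => rfl, fun a _ h => absurd (mem_univ a) h,
      fun _ _ _ _ h => h⟩
  | succ n ih =>
    intro S c hn hne hok
    by_cases hS : S = univ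
    · subst hS
      exact ⟨c, hok, subset_univ _, fun _ _ => rfl, fun a _ h => absurd (mem_univ a) h,
        fun _ _ _ _ h => h⟩
    obtain ⟨p, hp, w, hw, hpw⟩ := exists_boundary G hconn S hne hS
    obtain ⟨f, hf, hext, -, -⟩ := step G D hdeg hT hQ S c hok p hp p 0 (fun h => absurd hp h)
    obtain ⟨f', hf', hext'⟩ := ih (S ∪ G.neighborFinset p) f (by
      have : (S ∪ G.neighborFinset p)ᶜ ⊂ Sᶜ := by
        rw [compl_ssubset_compl, ssubset_iff_of_subset subset_union_left]
        exact ⟨w, by simp [hpw], hw⟩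
      have := card_lt_card this
      omega) (hne.mono subset_union_left) hf
    exact ⟨f', hf', hext.trans hext'⟩

/-- The six-cycle case. -/
theorem six_cycle (G : SimpleGraph V) [DecidableRel G.Adj] (hconn : G.Connected)
    (hreg : ∀ v, G.degree v = 2) (g : Fin 6 → V) (hinj : Function.Injective g)
    (hadj : ∀ i, G.Adj (g i) (g (i + 1))) : Nonempty (G ≃g cycleGraph 6) := by
  have hnb : ∀ i, G.neighborFinset (g i) = {g (i + 1), g (i - 1)} := by
    intro i
    symm
    apply eq_of_subset_of_card_le
    · intro w hw
      rw [mem_insert, mem_singleton] at hw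
      rw [mem_neighborFinset]
      rcases hw with rfl | rfl
      · exact hadj i
      · have := hadj (i - 1)
        rw [sub_add_cancel] at this
        exact this.symm
    · rw [card_neighborFinset_eq_degree, hreg, card_pair]
      intro h
      have h2 := hinj h
      clear h
      revert i; decide
  have hnb' : ∀ i w, G.Adj (g i) w ↔ w = g (i + 1) ∨ w = g (i - 1) := by
    intro i w
    rw [← mem_neighborFinset, hnb]; simp
  have hsurj : Function.Surjective g := by
    by_contra hcon
    have : univ.image g ≠ univ := by
      intro h
      apply hcon
      intro w
      have := h ▸ mem_univ w
      simpa using this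
    obtain ⟨p, hp, w, hw, hpw⟩ := exists_boundary G hconn _ (by simp) this
    rw [mem_image] at hp
    obtain ⟨i, -, rfl⟩ := hp
    rw [hnb'] at hpw
    apply hw
    rcases hpw with rfl | rfl <;> simp
  have e : cycleGraph 6 ≃g G := by
    refine ⟨Equiv.ofBijective g ⟨hinj, hsurj⟩, ?_⟩
    intro i j
    change G.Adj (g i) (g j) ↔ _
    rw [hnb', hinj.eq_iff, hinj.eq_iff]
    clear hnb hnb' hsurj hadj hinj
    revert i j; decide
  exact ⟨e.symm⟩

theorem irregular (G : SimpleGraph V) [DecidableRel G.Adj] (hconn : G.Connected)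
    (D : ℕ) (hdeg : ∀ v, G.degree v ≤ D)
    (hT : ∀ a b c, G.Adj a b → G.Adj b c → G.Adj c a → False)
    (hQ : ∀ a b c d, a ≠ b → G.Adj c a → G.Adj c b → G.Adj d a → G.Adj d b → c = d)
    (v u : V) (hvu : G.Adj v u) (hv : G.degree v < D) :
    ∃ f : V → ℕ, (∀ a b, G.Adj a b → f a ≠ f b) ∧ (∀ a, f a ≤ D) ∧
      ∀ φ : G ≃g G, (∀ a, f (φ a) = f a) → ∀ a, φ a = a := by
  obtain ⟨g, g1, g2, -⟩ := exists_inj_pin (G.neighborFinset v) (Finset.Icc 1 D)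
    (by rw [card_neighborFinset_eq_degree, Nat.card_Icc]; omega) v 0 (by simp)
  have g1' : ∀ w, G.Adj v w → 1 ≤ g w ∧ g w ≤ D := by
    intro w hw
    simpa using g1 w (by simpa using hw)
  set c : V → ℕ := fun a => if a = v then 0 else g a with hc
  have cv : c v = 0 := by simp [hc]
  have cu : ∀ a, G.Adj v a → c a = g a := fun a ha => by simp [hc, ha.ne']
  set S : Finset V := insert v (G.neighborFinset v) with hS
  have mS : ∀ a, a ∈ S ↔ a = v ∨ G.Adj v a := by intro a; simp [hS]
  have hok : OkCol G D S c := by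
    refine ⟨?_, ?_, ?_⟩
    · intro a ha b hb hab
      rw [mS] at ha hb
      rcases ha with rfl | ha
      · rw [cv, cu b hab]; have := g1' b hab; omega
      · rcases hb with rfl | hb
        · rw [cv, cu a ha]; have := g1' a ha; omega
        · exact (hT v a b ha hab hb.symm).elim
    · intro a ha
      rw [mS] at ha
      rcases ha with rfl | ha
      · rw [cv]; omega
      · rw [cu a ha]; exact (g1' a ha).2
    · intro a ha
      rw [mS] at ha
      rcases ha with rfl | ha
      · exact ⟨u, (mS u).2 (Or.inr hvu), hvu⟩
      · exact ⟨v, (mS v).2 (Or.inl rfl), ha.symm⟩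
  obtain ⟨f, ⟨p1, p2, -⟩, -, e2, e3, e4⟩ := iterate G hconn D hdeg hT hQ _ S c le_rfl
    ⟨v, (mS v).2 (Or.inl rfl)⟩ hok
  refine ⟨f, fun a b => p1 a (mem_univ a) b (mem_univ b), fun a => p2 a (mem_univ a), ?_⟩
  intro φ hφ a
  refine e4 f φ (fun _ _ => rfl) hφ ?_ a (mem_univ a)
  have fv : f v = 0 := by rw [e2 v ((mS v).2 (Or.inl rfl)), cv]
  have fu : ∀ a, G.Adj v a → f a = g a := fun a ha => by rw [e2 a ((mS a).2 (Or.inr ha)), cu a ha]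
  have hφv : φ v = v := by
    have h0 : f (φ v) = 0 := by rw [hφ, fv]
    by_cases hin : φ v ∈ S
    · rw [mS] at hin
      rcases hin with h | h
      · exact h
      · have := g1' _ h
        rw [fu _ h] at h0
        omega
    · exfalso
      have hall := e3 _ (mem_univ _) hin h0
      have hd : G.degree (φ v) = G.degree v := φ.degree_eq v
      have : Finset.Icc 1 D ⊆ (G.neighborFinset (φ v)).image f := by
        intro k hk
        rw [mem_Icc] at hk
        obtain ⟨b, -, h1, h2⟩ := hall k hk.1 hk.2
        exact mem_image.2 ⟨b, by simpa using h1, h2⟩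
      have h1 := (card_le_card this).trans card_image_le
      rw [card_neighborFinset_eq_degree, Nat.card_Icc] at h1
      omega
  intro b hb
  rw [mS] at hb
  rcases hb with rfl | hb
  · exact hφv
  · have hb' : G.Adj v (φ b) := by
      have := (φ.map_adj_iff).2 hb
      rwa [hφv] at this
    apply g2 _ (by simpa using hb') _ (by simpa using hb)
    rw [← fu _ hb', ← fu _ hb, hφ]

set_option maxHeartbeats 1600000 in
theorem regular (G : SimpleGraph V) [DecidableRel G.Adj] (hconn : G.Connected)
    (D : ℕ) (hD : 2 ≤ D) (hreg : ∀ v, G.degree v = D)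
    (hT : ∀ a b c, G.Adj a b → G.Adj b c → G.Adj c a → False)
    (hQ : ∀ a b c d, a ≠ b → G.Adj c a → G.Adj c b → G.Adj d a → G.Adj d b → c = d)
    (hC6 : ¬ Nonempty (G ≃g cycleGraph 6)) (v : V) :
    ∃ f : V → ℕ, (∀ a b, G.Adj a b → f a ≠ f b) ∧ (∀ a, f a ≤ D) ∧
      ∀ φ : G ≃g G, (∀ a, f (φ a) = f a) → ∀ a, φ a = a := by
  have hdeg : ∀ v, G.degree v ≤ D := fun v => (hreg v).le
  have other : ∀ a b, ∃ w, G.Adj a w ∧ w ≠ b := by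
    intro a b
    have : 1 < #(G.neighborFinset a) := by rw [card_neighborFinset_eq_degree, hreg]; omega
    obtain ⟨w, hw, hwb⟩ := exists_mem_ne this b
    exact ⟨w, by simpa using hw, hwb⟩
  obtain ⟨u1, hu1, -⟩ := other v v
  obtain ⟨u2, hu2, hu21⟩ := other v u1
  obtain ⟨x, hx, hxv⟩ := other u1 v
  obtain ⟨y, hy, hyu1⟩ := other x u1
  have hvx : ¬ G.Adj v x := fun h => hT v u1 x hu1 hx h.symm
  -- colours on the neighbourhood of v
  obtain ⟨g, g1, g2, -⟩ := exists_inj_pin ((G.neighborFinset v).erase u1) (Finset.Icc 1 (D - 1))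
    (by rw [card_erase_of_mem (by simpa using hu1), card_neighborFinset_eq_degree, hreg,
          Nat.card_Icc]; omega) v 0 (by simp)
  have g1' : ∀ w, G.Adj v w → w ≠ u1 → 1 ≤ g w ∧ g w ≤ D - 1 := by
    intro w hw hne
    simpa using g1 w (by simpa using ⟨hne, hw⟩)
  set c : V → ℕ := fun a => if a = v ∨ a = x then 0 else if a = u1 then g u2 else g a with hc
  have cv : c v = 0 := by simp [hc]
  have cx : c x = 0 := by simp [hc]
  have cu1 : c u1 = g u2 := by simp [hc, hu1.ne', hx.ne]
  have cu : ∀ a, G.Adj v a → a ≠ u1 → c a = g a := fun a ha hne => by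
    have : a ≠ x := fun h => hvx (h ▸ ha)
    simp [hc, ha.ne', hne, this]
  have cb : ∀ a, G.Adj v a → 1 ≤ c a ∧ c a ≤ D - 1 := by
    intro a ha
    by_cases h : a = u1
    · rw [h, cu1]; exact g1' u2 hu2 hu21
    · rw [cu a ha h]; exact g1' a ha h
  set S : Finset V := insert x (insert v (G.neighborFinset v)) with hS
  have mS : ∀ a, a ∈ S ↔ a = x ∨ a = v ∨ G.Adj v a := by intro a; simp [hS]
  have vS : v ∈ S := (mS v).2 (Or.inr (Or.inl rfl))
  have xS : x ∈ S := (mS x).2 (Or.inl rfl)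
  have nS : ∀ a, G.Adj v a → a ∈ S := fun a ha => (mS a).2 (Or.inr (Or.inr ha))
  have hok : OkCol G D S c := by
    refine ⟨?_, ?_, ?_⟩
    · intro a ha b hb hab
      rw [mS] at ha hb
      rcases ha with rfl | rfl | ha <;> rcases hb with rfl | rfl | hb
      · exact (G.irrefl hab).elim
      · exact (hvx hab.symm).elim
      · rw [cx]; have := cb b hb; omega
      · exact (hvx hab).elim
      · exact (G.irrefl hab).elim
      · rw [cv]; have := cb b hb; omega
      · rw [cx]; have := cb a ha; omega
      · rw [cv]; have := cb a ha; omega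
      · exact (hT v a b ha hab hb.symm).elim
    · intro a ha
      rw [mS] at ha
      rcases ha with rfl | rfl | ha
      · omega
      · omega
      · have := cb a ha; omega
    · intro a ha
      rw [mS] at ha
      rcases ha with rfl | rfl | ha
      · exact ⟨u1, nS u1 hu1, hx.symm⟩
      · exact ⟨u1, nS u1 hu1, hu1⟩
      · exact ⟨v, vS, ha.symm⟩
  have cS : ∀ a ∈ S, c a ≠ D := by
    intro a ha
    rw [mS] at ha
    rcases ha with rfl | rfl | ha
    · omega
    · omega
    · have := cb a ha; omega
  have yS : y ∉ S := by
    rw [mS]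
    rintro (h | h | h)
    · exact hy.ne' h
    · exact hvx (h ▸ hy.symm)
    · exact hyu1 (hQ v x y u1 hxv.symm h.symm hy.symm hu1.symm hx)
  -- step at x
  obtain ⟨c1, ok1, ext1, z1, y1⟩ := step G D hdeg hT hQ S c hok x xS y D
    (fun _ => ⟨by omega, le_rfl, fun b hb _ => cS b hb⟩)
  set S1 := S ∪ G.neighborFinset x with hS1
  have mS1 : ∀ a, a ∈ S1 ↔ a ∈ S ∨ G.Adj x a := by intro a; simp [hS1]
  have u2S1 : u2 ∈ S1 := (mS1 _).2 (Or.inl (nS _ hu2))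
  -- step at u2
  obtain ⟨c2, ok2, ext2, z2, -⟩ := step G D hdeg hT hQ S1 c1 ok1 u2 u2S1 u2 0
    (fun h => absurd u2S1 h)
  set S2 := S1 ∪ G.neighborFinset u2 with hS2
  have mS2 : ∀ a, a ∈ S2 ↔ a ∈ S1 ∨ G.Adj u2 a := by intro a; simp [hS2]
  have u1S2 : u1 ∈ S2 := (mS2 _).2 (Or.inl ((mS1 _).2 (Or.inl (nS _ hu1))))
  -- step at u1
  obtain ⟨c3, ok3, ext3, z3, -⟩ := step G D hdeg hT hQ S2 c2 ok2 u1 u1S2 u1 0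
    (fun h => absurd u1S2 h)
  set S3 := S2 ∪ G.neighborFinset u1 with hS3
  have mS3 : ∀ a, a ∈ S3 ↔ a ∈ S2 ∨ G.Adj u1 a := by intro a; simp [hS3]
  have sub1 := ext1.1
  have sub2 := ext2.1
  have sub3 := ext3.1
  obtain ⟨f, okf, extf⟩ := iterate G hconn D hdeg hT hQ _ S3 c3 le_rfl
    ⟨v, sub3 (sub2 (sub1 vS))⟩ ok3
  have f3 : ∀ a ∈ S3, f a = c3 a := extf.2.1
  have f2 : ∀ a ∈ S2, f a = c2 a := fun a ha => (f3 a (sub3 ha)).trans (ext3.2.1 a ha)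
  have f1 : ∀ a ∈ S1, f a = c1 a := fun a ha => (f2 a (sub2 ha)).trans (ext2.2.1 a ha)
  have f0 : ∀ a ∈ S, f a = c a := fun a ha => (f1 a (sub1 ha)).trans (ext1.2.1 a ha)
  have ext := ((ext1.trans ext2).trans ext3).trans extf
  have pf : ∀ a b, G.Adj a b → f a ≠ f b := fun a b => okf.1 a (mem_univ a) b (mem_univ b)
  have fy : f y = D := by
    rw [f1 y ((mS1 y).2 (Or.inr hy))]; exact y1 hy yS
  have fv : f v = 0 := by rw [f0 v vS, cv]
  have fx : f x = 0 := by rw [f0 x xS, cx]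
  have fu1 : f u1 = g u2 := by rw [f0 u1 (nS _ hu1), cu1]
  have fu : ∀ a, G.Adj v a → a ≠ u1 → f a = g a := fun a ha h => by rw [f0 a (nS _ ha), cu a ha h]
  have fb : ∀ a, G.Adj v a → 1 ≤ f a ∧ f a ≤ D - 1 := fun a ha => by rw [f0 a (nS _ ha)]; exact cb a ha
  have fu2 : f u2 = g u2 := fu u2 hu2 hu21
  have gb := g1' u2 hu2 hu21
  -- no vertex of colour 0 next to u2 except v
  have key2 : ∀ w, G.Adj u2 w → w ≠ v → f w ≠ 0 := by
    intro w hw hwv hw0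
    by_cases hxw : G.Adj x w
    · exact pf x w hxw (by rw [fx, hw0])
    have hwx : w ≠ x := by
      rintro rfl
      exact hu21 (hQ v w u2 u1 hxv.symm hu2.symm hw hu1.symm hx)
    have hvw : ¬ G.Adj v w := fun h => hT v u2 w hu2 hw h.symm
    have hwS1 : w ∉ S1 := by
      rw [mS1, mS]; tauto
    have hz := z2 w hw hwS1 (by rw [← f2 w ((mS2 w).2 (Or.inr hw))]; exact hw0)
    -- coloured neighbours of w
    have hloc : ∀ b ∈ S1, G.Adj w b → b ≠ u2 → G.Adj x b := by
      intro b hb hwb hbu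
      rw [mS1, mS] at hb
      rcases hb with (rfl | rfl | hb) | hb
      · exact (hxw hwb.symm).elim
      · exact (hvw hwb.symm).elim
      · exact (hbu (hQ v w b u2 hwv.symm hb.symm hwb.symm hu2.symm hw)).elim
      · exact hb
    have cu2 : c1 u2 = g u2 := by rw [← f1 u2 u2S1, fu2]
    by_cases hD3 : 3 ≤ D
    · -- two colours different from the colour of u2
      obtain ⟨k, k', hk, hk', hkk, hku, hku'⟩ : ∃ k k', (1 ≤ k ∧ k ≤ D) ∧ (1 ≤ k' ∧ k' ≤ D) ∧
          k ≠ k' ∧ k ≠ g u2 ∧ k' ≠ g u2 := by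
        by_cases h1 : g u2 = 1
        · exact ⟨2, 3, by omega, by omega, by omega, by omega, by omega⟩
        · by_cases h2 : g u2 = 2
          · exact ⟨1, 3, by omega, by omega, by omega, by omega, by omega⟩
          · exact ⟨1, 2, by omega, by omega, by omega, by omega, by omega⟩
      obtain ⟨b, hb, hwb, hbk⟩ := hz k hk.1 hk.2
      obtain ⟨b', hb', hwb', hbk'⟩ := hz k' hk'.1 hk'.2
      have e1 := hloc b hb hwb (by rintro rfl; omega)
      have e2 := hloc b' hb' hwb' (by rintro rfl; omega)
      have := hQ w x b b' hwx hwb.symm e1.symm hwb'.symm e2.symm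
      subst this
      omega
    · have hD2 : D = 2 := by omega
      obtain ⟨z, hzS, hwz, hzk⟩ := hz 2 (by omega) (by omega)
      have hzu2 : z ≠ u2 := by rintro rfl; omega
      have hxz := hloc z hzS hwz hzu2
      have hzu1 : z ≠ u1 := by
        rintro rfl
        have := (f1 z hzS).symm
        omega
      have hzv : z ≠ v := by rintro rfl; exact hvx hxz.symm
      have hu2x : u2 ≠ x := by rintro rfl; exact hvx hu2
      have hwu1 : w ≠ u1 := by rintro rfl; exact hvw hu1
      apply hC6
      apply six_cycle G hconn (fun v => by rw [hreg, hD2]) ![v, u1, x, z, w, u2]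
      · exact inj_six hu1.ne hxv.symm hzv.symm hwv.symm hu2.ne hx.ne hzu1.symm hwu1.symm
          hu21.symm hxz.ne hwx.symm hu2x.symm hwz.ne.symm hzu2 hw.ne.symm
      · intro i
        fin_cases i
        · exact hu1
        · exact hx
        · exact hxz
        · exact hwz.symm
        · exact hw.symm
        · exact hu2.symm
  -- no vertex of colour 0 next to u1 except v and x
  have key1 : ∀ w, G.Adj u1 w → w ≠ v → w ≠ x → f w ≠ 0 := by
    intro w hw hwv hwx hw0
    have hvw : ¬ G.Adj v w := fun h => hT v u1 w hu1 hw h.symm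
    have hxw : ¬ G.Adj x w := fun h => hT x u1 w hx.symm hw h.symm
    have hu2w : ¬ G.Adj u2 w := fun h =>
      hu21 (hQ v w u2 u1 hwv.symm hu2.symm h hu1.symm hw)
    have hwS2 : w ∉ S2 := by
      rw [mS2, mS1, mS]; tauto
    have hz := z3 w hw hwS2 (by rw [← f3 w ((mS3 w).2 (Or.inr hw))]; exact hw0)
    have hloc : ∀ b ∈ S2, G.Adj w b → b ≠ u1 → G.Adj u2 b := by
      intro b hb hwb hbu
      rw [mS2, mS1, mS] at hb
      rcases hb with ((rfl | rfl | hb) | hb) | hb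
      · exact (hxw hwb.symm).elim
      · exact (hvw hwb.symm).elim
      · exact (hbu (hQ v w b u1 hwv.symm hb.symm hwb.symm hu1.symm hw)).elim
      · exact (hbu (hQ x w b u1 hwx.symm hb.symm hwb.symm hx hw)).elim
      · exact hb
    have hwu2 : w ≠ u2 := by rintro rfl; exact hvw hu2
    have cu1' : c2 u1 = g u2 := by rw [← f2 u1 u1S2, fu1]
    have hD3 : 3 ≤ D := by
      rw [← hreg u1, ← card_neighborFinset_eq_degree]
      have : ({v, x, w} : Finset V) ⊆ G.neighborFinset u1 := by
        intro a ha
        simp only [mem_insert, mem_singleton] at ha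
        rw [mem_neighborFinset]
        rcases ha with rfl | rfl | rfl
        · exact hu1.symm
        · exact hx
        · exact hw
      have h3 : #({v, x, w} : Finset V) = 3 := by
        rw [card_eq_three]
        exact ⟨v, x, w, hxv.symm, hwv.symm, hwx.symm, rfl⟩
      rw [← h3]; exact card_le_card this
    obtain ⟨k, k', hk, hk', hkk, hku, hku'⟩ : ∃ k k', (1 ≤ k ∧ k ≤ D) ∧ (1 ≤ k' ∧ k' ≤ D) ∧
        k ≠ k' ∧ k ≠ g u2 ∧ k' ≠ g u2 := by
      by_cases h1 : g u2 = 1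
      · exact ⟨2, 3, by omega, by omega, by omega, by omega, by omega⟩
      · by_cases h2 : g u2 = 2
        · exact ⟨1, 3, by omega, by omega, by omega, by omega, by omega⟩
        · exact ⟨1, 2, by omega, by omega, by omega, by omega, by omega⟩
    obtain ⟨b, hb, hwb, hbk⟩ := hz k hk.1 hk.2
    obtain ⟨b', hb', hwb', hbk'⟩ := hz k' hk'.1 hk'.2
    have e1 := hloc b hb hwb (by rintro rfl; omega)
    have e2 := hloc b' hb' hwb' (by rintro rfl; omega)
    have := hQ w u2 b b' hwu2 hwb.symm e1.symm hwb'.symm e2.symm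
    subst this
    omega
  refine ⟨f, pf, fun a => okf.2.1 a (mem_univ a), ?_⟩
  intro φ hφ a
  refine ext.2.2.2 f φ (fun _ _ => rfl) hφ ?_ a (mem_univ a)
  have hφv : φ v = v := by
    have h0 : f (φ v) = 0 := by rw [hφ, fv]
    have hnoD : ∀ b, G.Adj (φ v) b → f b ≠ D := by
      intro b hb hbD
      have h1 : G.Adj v (φ.symm b) := by
        rw [← φ.map_adj_iff]; simpa using hb
      have h2 := fb _ h1
      have h3 := hφ (φ.symm b)
      rw [φ.apply_symm_apply] at h3
      omega
    by_cases hin : φ v ∈ S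
    · rw [mS] at hin
      rcases hin with h | h | h
      · exact (hnoD y (h ▸ hy) fy).elim
      · exact h
      · have := fb _ h
        omega
    · obtain ⟨b, -, hb, hbD⟩ := ext.2.2.1 _ (mem_univ _) hin h0 D (by omega) le_rfl
      exact (hnoD b hb hbD).elim
  have hnv : ∀ b, G.Adj v b → G.Adj v (φ b) := by
    intro b hb
    have := (φ.map_adj_iff).2 hb
    rwa [hφv] at this
  have ginj : ∀ a b, G.Adj v a → a ≠ u1 → G.Adj v b → b ≠ u1 → g a = g b → a = b := by
    intro a b ha ha1 hb hb1 hab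
    exact g2 a (by simpa using ⟨ha1, ha⟩) b (by simpa using ⟨hb1, hb⟩) hab
  have hφu1 : φ u1 = u1 := by
    by_contra hne
    have h1 := hnv u1 hu1
    have h2 : g (φ u1) = g u2 := by rw [← fu _ h1 hne, hφ, fu1]
    have h3 := ginj _ _ h1 hne hu2 hu21 h2
    have h4 : G.Adj u2 (φ x) := by rw [← h3]; exact (φ.map_adj_iff).2 hx
    refine key2 (φ x) h4 ?_ (by rw [hφ, fx])
    intro h
    exact hxv (φ.injective (h.trans hφv.symm))
  intro b hb
  rw [mS] at hb
  rcases hb with rfl | rfl | hb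
  · by_contra hne
    refine key1 (φ b) ?_ ?_ hne (by rw [hφ, fx])
    · have := (φ.map_adj_iff).2 hx
      rwa [hφu1] at this
    · intro h
      exact hxv (φ.injective (h.trans hφv.symm))
  · exact hφv
  · by_cases hb1 : b = u1
    · rw [hb1, hφu1]
    · have h1 : φ b ≠ u1 := fun h => hb1 (φ.injective (h.trans hφu1.symm))
      apply ginj _ _ (hnv b hb) h1 hb hb1
      rw [← fu _ (hnv b hb) h1, ← fu _ hb hb1, hφ]

end helpers

theorem statement_1 {V : Type*} [Fintype V] (G : SimpleGraph V)
    (hconn : G.Connected)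
    (hC3 : G.IsFreeOf (cycleGraph 3)) (hC4 : G.IsFreeOf (cycleGraph 4))
    (hC6 : ¬ Nonempty (G ≃g cycleGraph 6)) :
    G.distChromNum ≤ G.maxDeg + 1 := by
  classical
  have hT := no_tri G hC3
  have hQ := no_quad G hC3 hC4
  have hmd : G.maxDeg = G.maxDegree := by
    unfold SimpleGraph.maxDeg
    congr!
  rw [hmd]
  set D := G.maxDegree with hD
  have hdeg : ∀ v, G.degree v ≤ D := fun v => G.degree_le_maxDegree v
  suffices hmain : ∃ f : V → ℕ, (∀ a b, G.Adj a b → f a ≠ f b) ∧ (∀ a, f a ≤ D) ∧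
      ∀ φ : G ≃g G, (∀ a, f (φ a) = f a) → ∀ a, φ a = a by
    obtain ⟨f, h1, h2, h3⟩ := hmain
    apply Nat.sInf_le
    refine ⟨SimpleGraph.Coloring.mk (fun a => ⟨f a, Nat.lt_succ_of_le (h2 a)⟩) ?_, ?_⟩
    · intro a b hab h
      exact h1 a b hab (by simpa using h)
    · intro φ hφ
      apply h3 φ
      intro a
      have := hφ a
      exact congrArg Fin.val this
  obtain ⟨v⟩ := hconn.nonempty
  by_cases hsub : Subsingleton V
  · exact ⟨fun _ => 0, fun a b hab => (hab.ne (Subsingleton.elim _ _)).elim, fun _ => Nat.zero_le _,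
      fun _ _ _ => Subsingleton.elim _ _⟩
  have hnt : Nontrivial V := not_subsingleton_iff_nontrivial.1 hsub
  have hpos : ∀ a, ∃ b, G.Adj a b := fun a => hconn.preconnected.exists_adj_of_nontrivial a
  by_cases hirr : ∃ v, G.degree v < D
  · obtain ⟨v, hv⟩ := hirr
    obtain ⟨u, hu⟩ := hpos v
    exact irregular G hconn D hdeg hT hQ v u hu hv
  push Not at hirr
  have hreg : ∀ v, G.degree v = D := fun v => le_antisymm (hdeg v) (hirr v)
  by_cases hD2 : 2 ≤ D
  · exact regular G hconn D hD2 hreg hT hQ hC6 v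
  -- G is a single edge
  obtain ⟨u, hu⟩ := hpos v
  have hD1 : D = 1 := by
    have : 0 < G.degree v := (G.degree_pos_iff_exists_adj v).2 ⟨u, hu⟩
    have := hreg v
    omega
  have huniq : ∀ a b b', G.Adj a b → G.Adj a b' → b = b' := by
    intro a b b' h h'
    have : (G.neighborFinset a).card ≤ 1 := by
      rw [card_neighborFinset_eq_degree, hreg, hD1]
    exact Finset.card_le_one.1 this b (by simpa using h) b' (by simpa using h')
  have hall : ∀ w, w = v ∨ w = u := by
    by_contra hcon
    push Not at hcon
    obtain ⟨w, hw1, hw2⟩ := hcon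
    obtain ⟨p, hp, z, hz, hpz⟩ := exists_boundary G hconn {v, u} (by simp) (by
      intro h
      have := h ▸ Finset.mem_univ w
      simp [hw1, hw2] at this)
    simp only [Finset.mem_insert, Finset.mem_singleton] at hp hz
    push Not at hz
    rcases hp with rfl | rfl
    · exact hz.2 (huniq _ _ _ hpz hu)
    · exact hz.1 (huniq _ _ _ hpz hu.symm)
  refine ⟨fun a => if a = v then 0 else 1, ?_, ?_, ?_⟩
  · intro a b hab
    have h1 := hab.ne
    have h2 := hall a
    have h3 := hall b
    have h4 := hu.ne
    clear_value D
    dsimp only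
    split_ifs <;> grind
  · intro a
    dsimp only
    split_ifs <;> omega
  · intro φ hφ a
    have h1 := hφ a
    dsimp only at h1
    have h2 := hall a
    have h3 := hall (φ a)
    clear hφ
    split_ifs at h1 <;> grind
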